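/- Let a > 0, b > 0, c > 0, 0 < α < 2 and β > 2, and define f(z) = a z² + b z^α − c z^β for z ∈ (0, ∞). Then f attains its maximum on (0, ∞) at a unique point z₀ > 0, f is concave on [z₀, ∞), and f″(z₀) < 0. -/

import Mathlib

open Set

noncomputable section

/-- The function `f(z) = a z² + b z^α − c z^β` (with real-power exponents). -/
def powFun (a b c α β : ℝ) : ℝ → ℝ :=
  fun z => a * z ^ 2 + b * z ^ α - c * z ^ β

/-- The quotient `f′(z) / z` for `f = powFun a b c α β`. -/
def powFunSlope (a b c α β : ℝ) : ℝ → ℝ :=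
  fun z => 2 * a + b * α * z ^ (α - 2) - c * β * z ^ (β - 2)

theorem hasDerivAt_powFun (a b c α β : ℝ) {z : ℝ} (hz : 0 < z) :
    HasDerivAt (powFun a b c α β) (z * powFunSlope a b c α β z) z := by
  have h1 := (hasDerivAt_pow 2 z).const_mul a
  have h2 := (Real.hasDerivAt_rpow_const (p := α) (Or.inl hz.ne')).const_mul b
  have h3 := (Real.hasDerivAt_rpow_const (p := β) (Or.inl hz.ne')).const_mul c
  refine ((h1.add h2).sub h3).congr_deriv ?_
  have e (p : ℝ) : z ^ (p - 1) = z * z ^ (p - 2) := by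
    rw [show p - 1 = 1 + (p - 2) by ring, Real.rpow_add hz, Real.rpow_one]
  rw [e α, e β, powFunSlope]
  push_cast
  ring

theorem hasDerivAt_powFunSlope (a b c α β : ℝ) {z : ℝ} (hz : 0 < z) :
    HasDerivAt (powFunSlope a b c α β)
      (b * α * ((α - 2) * z ^ (α - 2 - 1)) - c * β * ((β - 2) * z ^ (β - 2 - 1))) z := by
  have h2 := (Real.hasDerivAt_rpow_const (p := α - 2) (Or.inl hz.ne')).const_mul (b * α)
  have h3 := (Real.hasDerivAt_rpow_const (p := β - 2) (Or.inl hz.ne')).const_mul (c * β)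
  exact (h2.const_add (2 * a)).sub h3

theorem deriv_powFunSlope_neg (a : ℝ) {b c α β z : ℝ} (hb : 0 < b) (hc : 0 < c)
    (hα0 : 0 < α) (hα2 : α < 2) (hβ : 2 < β) (hz : 0 < z) :
    deriv (powFunSlope a b c α β) z < 0 := by
  rw [(hasDerivAt_powFunSlope a b c α β hz).deriv]
  have h1 : 0 < b * α * ((2 - α) * z ^ (α - 2 - 1)) :=
    mul_pos (mul_pos hb hα0) (mul_pos (by linarith) (Real.rpow_pos_of_pos hz _))
  have h2 : 0 < c * β * ((β - 2) * z ^ (β - 2 - 1)) :=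
    mul_pos (mul_pos hc (by linarith)) (mul_pos (by linarith) (Real.rpow_pos_of_pos hz _))
  linarith

theorem continuousOn_powFunSlope (a b c α β : ℝ) :
    ContinuousOn (powFunSlope a b c α β) (Ioi 0) := fun _ hz =>
  (hasDerivAt_powFunSlope a b c α β hz).continuousAt.continuousWithinAt

theorem strictAntiOn_powFunSlope (a : ℝ) {b c α β : ℝ} (hb : 0 < b) (hc : 0 < c)
    (hα0 : 0 < α) (hα2 : α < 2) (hβ : 2 < β) :
    StrictAntiOn (powFunSlope a b c α β) (Ioi 0) := by
  refine strictAntiOn_of_deriv_neg (convex_Ioi 0) (continuousOn_powFunSlope a b c α β) ?_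
  intro z hz
  rw [interior_Ioi] at hz
  exact deriv_powFunSlope_neg a hb hc hα0 hα2 hβ hz

theorem exists_powFunSlope_eq_zero {a b c α β : ℝ} (ha : 0 < a) (hb : 0 < b) (hc : 0 < c)
    (hα0 : 0 < α) (hα2 : α < 2) (hβ : 2 < β) :
    ∃ z, 0 < z ∧ powFunSlope a b c α β z = 0 := by
  have hcβ : 0 < c * β := mul_pos hc (by linarith)
  have hbα : 0 < b * α := mul_pos hb hα0
  have hβ2 : β - 2 ≠ 0 := by linarith
  set M := 2 * a / (c * β) with hM
  set N := max 1 ((2 * a + b * α) / (c * β))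
  have hM0 : 0 < M := by positivity
  have hN1 : 1 ≤ N := le_max_left _ _
  have hN0 : 0 < N := by linarith
  have hpos : 0 ≤ powFunSlope a b c α β (M ^ (β - 2)⁻¹) := by
    have h1 : c * β * M = 2 * a := by rw [hM]; field_simp
    have h2 : 0 < b * α * (M ^ (β - 2)⁻¹) ^ (α - 2) := by positivity
    rw [powFunSlope, Real.rpow_inv_rpow hM0.le hβ2, h1]
    linarith
  have hneg : powFunSlope a b c α β (N ^ (β - 2)⁻¹) ≤ 0 := by
    have h1 : 2 * a + b * α ≤ N * (c * β) := (div_le_iff₀ hcβ).1 (le_max_right _ _)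
    have h2 : 1 ≤ N ^ (β - 2)⁻¹ :=
      Real.one_le_rpow hN1 (inv_nonneg.2 (by linarith))
    have h3 : (N ^ (β - 2)⁻¹) ^ (α - 2) ≤ 1 :=
      Real.rpow_le_one_of_one_le_of_nonpos h2 (by linarith)
    have h4 := mul_le_mul_of_nonneg_left h3 hbα.le
    rw [powFunSlope, Real.rpow_inv_rpow hN0.le hβ2]
    linarith
  obtain ⟨z, hz, h⟩ := isPreconnected_Ioi.intermediate_value
    (Real.rpow_pos_of_pos hN0 _) (Real.rpow_pos_of_pos hM0 _)
    (continuousOn_powFunSlope a b c α β) ⟨hneg, hpos⟩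
  exact ⟨z, hz, h⟩

/-- if `a, b, c > 0`, `0 < α < 2` and `β > 2`, then `f` attains its
maximum on `(0, ∞)` at a unique point `z₀ > 0`, `f` is concave on `[z₀, ∞)`, and
`f″(z₀) < 0`. -/
theorem statement3 (a b c α β : ℝ) (ha : 0 < a) (hb : 0 < b) (hc : 0 < c)
    (hα0 : 0 < α) (hα2 : α < 2) (hβ : 2 < β) :
    ∃ z₀ : ℝ, 0 < z₀ ∧ IsMaxOn (powFun a b c α β) (Ioi 0) z₀ ∧
      (∀ z : ℝ, 0 < z → IsMaxOn (powFun a b c α β) (Ioi 0) z → z = z₀) ∧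
      ConcaveOn ℝ (Ici z₀) (powFun a b c α β) ∧
      deriv (deriv (powFun a b c α β)) z₀ < 0 := by
  obtain ⟨z₀, hz₀, hzero⟩ := exists_powFunSlope_eq_zero ha hb hc hα0 hα2 hβ
  have hanti := strictAntiOn_powFunSlope a hb hc hα0 hα2 hβ
  have hcont : ContinuousOn (powFun a b c α β) (Ioi 0) := fun z hz =>
    (hasDerivAt_powFun a b c α β hz).continuousAt.continuousWithinAt
  have hIci : Ici z₀ ⊆ Ioi 0 := fun z hz => hz₀.trans_le hz
  have hmono : StrictMonoOn (powFun a b c α β) (Ioc 0 z₀) := by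
    refine strictMonoOn_of_deriv_pos (convex_Ioc 0 z₀) (hcont.mono fun z hz => hz.1) ?_
    intro z hz
    rw [interior_Ioc] at hz
    rw [(hasDerivAt_powFun a b c α β hz.1).deriv]
    exact mul_pos hz.1 (hzero ▸ hanti hz.1 hz₀ hz.2)
  have hdecr : StrictAntiOn (powFun a b c α β) (Ici z₀) := by
    refine strictAntiOn_of_deriv_neg (convex_Ici z₀) (hcont.mono hIci) ?_
    intro z hz
    rw [interior_Ici] at hz
    have hz0 : 0 < z := hz₀.trans hz
    rw [(hasDerivAt_powFun a b c α β hz0).deriv]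
    exact mul_neg_of_pos_of_neg hz0 (hzero ▸ hanti hz₀ hz0 hz)
  have hlt : ∀ z, 0 < z → z ≠ z₀ → powFun a b c α β z < powFun a b c α β z₀ := by
    intro z hz hne
    rcases hne.lt_or_gt with h | h
    · exact hmono ⟨hz, h.le⟩ ⟨hz₀, le_rfl⟩ h
    · exact hdecr self_mem_Ici h.le h
  refine ⟨z₀, hz₀, ?_, ?_, ?_, ?_⟩
  · intro z hz
    rcases eq_or_ne z z₀ with rfl | h
    · exact le_refl (powFun a b c α β z)
    · exact (hlt z hz h).le
  · intro z hz hmax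
    by_contra hne
    exact (hlt z hz hne).not_ge (hmax hz₀)
  · refine AntitoneOn.concaveOn_of_deriv (convex_Ici z₀) (hcont.mono hIci) ?_ ?_
    · rw [interior_Ici]
      exact fun z hz => (hasDerivAt_powFun a b c α β
        (hz₀.trans hz)).differentiableAt.differentiableWithinAt
    · rw [interior_Ici]
      intro x hx y hy hxy
      have hx0 : 0 < x := hz₀.trans hx
      have hy0 : 0 < y := hz₀.trans hy
      rw [(hasDerivAt_powFun a b c α β hx0).deriv, (hasDerivAt_powFun a b c α β hy0).deriv]
      have h1 : powFunSlope a b c α β x ≤ 0 := hzero ▸ (hanti hz₀ hx0 hx).le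
      have h2 : powFunSlope a b c α β y ≤ powFunSlope a b c α β x :=
        hanti.antitoneOn hx0 hy0 hxy
      calc y * powFunSlope a b c α β y ≤ y * powFunSlope a b c α β x :=
            mul_le_mul_of_nonneg_left h2 hy0.le
        _ ≤ x * powFunSlope a b c α β x := mul_le_mul_of_nonpos_right hxy h1
  · have heq : deriv (powFun a b c α β) =ᶠ[nhds z₀] fun z => z * powFunSlope a b c α β z := by
      filter_upwards [Ioi_mem_nhds hz₀] with z hz
      exact (hasDerivAt_powFun a b c α β hz).deriv
    have hd := (hasDerivAt_id' z₀).mul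
      (hasDerivAt_powFunSlope a b c α β hz₀).differentiableAt.hasDerivAt
    rw [(hd.congr_of_eventuallyEq heq).deriv, hzero, mul_zero, zero_add]
    exact mul_neg_of_pos_of_neg hz₀ (deriv_powFunSlope_neg a hb hc hα0 hα2 hβ hz₀)
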